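/- There exist c > 0 and N₀ ∈ ℕ such that for every integer N ≥ N₀ the following holds. Set A = N/(log N)^{1/16}, let φ_N(x) = Σ_{n∈S} e^{2πinx} where S = {n ∈ ℤ : |n − N| ≤ A/2 or |n − 2N| ≤ A/2}, let w(x,t) = φ_N(x) e^{i|φ_N(x)|² t}, and set T_N = 1/(N² (log N)^{1/8}). Then (Σ_{n∈ℤ, |n|<N} (1+n²)^{−1/2} |ŵ(n, T_N)|²)^{1/2} ≥ c (log N)^{1/4}, where ŵ(n,t) = ∫₀¹ w(x,t) e^{−2πinx} dx. -/

import Mathlib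

open scoped Real

/-- Fourier coefficient of a 1-periodic function `f : ℝ → ℂ`:
`f̂(n) = ∫₀¹ f(x) e^{−2πinx} dx`. -/
noncomputable def fourierCoeff1 (f : ℝ → ℂ) (n : ℤ) : ℂ :=
  ∫ x in (0:ℝ)..1, f x * Complex.exp (-2 * (π : ℂ) * Complex.I * (n : ℂ) * (x : ℂ))

/-- `φ(x) = R Σ_{n∈S} e^{2πinx}` where
`S = {n ∈ ℤ : |n − N| ≤ A/2 or |n − 2N| ≤ A/2}`. -/
noncomputable def phiPacket (R A N : ℝ) (x : ℝ) : ℂ :=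
  (R : ℂ) * ∑' n : ℤ,
    if |(n:ℝ) - N| ≤ A/2 ∨ |(n:ℝ) - 2*N| ≤ A/2
      then Complex.exp (2 * (π : ℂ) * Complex.I * (n : ℂ) * (x : ℂ)) else 0

/-- Solution `w(x,t) = φ(x) e^{i|φ(x)|² t}` of the dispersionless ODE
`i∂_t w + |w|²w = 0`. -/
noncomputable def odeSol (φ : ℝ → ℂ) (x t : ℝ) : ℂ :=
  φ x * Complex.exp (Complex.I * ((‖φ x‖^2 : ℝ) : ℂ) * (t : ℂ))

noncomputable def eE (k : ℤ) (x : ℝ) : ℂ := Complex.exp (2 * (π : ℂ) * Complex.I * (k : ℂ) * (x : ℂ))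

lemma eE_add (a b : ℤ) (x : ℝ) : eE a x * eE b x = eE (a + b) x := by
  unfold eE; rw [← Complex.exp_add]; congr 1; push_cast; ring

lemma eE_conj (a : ℤ) (x : ℝ) : (starRingEnd ℂ) (eE a x) = eE (-a) x := by
  unfold eE; rw [← Complex.exp_conj]; congr 1
  have h2 : (starRingEnd ℂ) (2:ℂ) = 2 := Complex.conj_ofNat 2
  simp [Complex.conj_ofReal, h2]

lemma eE_cont (a : ℤ) : Continuous (eE a) := by unfold eE; fun_prop

lemma eE_norm (a : ℤ) (x : ℝ) : ‖eE a x‖ = 1 := by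
  unfold eE
  have : 2 * (π : ℂ) * Complex.I * (a : ℂ) * (x : ℂ) = ((2 * π * a * x : ℝ) : ℂ) * Complex.I := by
    push_cast; ring
  rw [this, Complex.norm_exp_ofReal_mul_I]

lemma eE_int (m : ℤ) : ∫ x in (0:ℝ)..1, eE m x = if m = 0 then 1 else 0 := by
  unfold eE
  split_ifs with h
  · subst h; simp
  · have hc : 2 * (π : ℂ) * Complex.I * (m : ℂ) ≠ 0 := by
      simp [h, Real.pi_ne_zero]
    rw [integral_exp_mul_complex hc]
    have : Complex.exp (2 * (π : ℂ) * Complex.I * (m : ℂ) * ((1:ℝ):ℂ)) = 1 := by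
      rw [Complex.exp_eq_one_iff]; exact ⟨m, by push_cast; ring⟩
    rw [this]; simp

noncomputable def pF (F : Finset ℤ) (x : ℝ) : ℂ := ∑ k ∈ F, eE k x

lemma pF_cont (F : Finset ℤ) : Continuous (pF F) := by
  unfold pF; exact continuous_finsetSum _ fun i _ => eE_cont i

lemma pF_norm (F : Finset ℤ) (x : ℝ) : ‖pF F x‖ ≤ F.card := by
  unfold pF
  refine (norm_sum_le _ _).trans ?_
  simp [eE_norm]

lemma pF_sq (F : Finset ℤ) (x : ℝ) :
    ((‖pF F x‖ ^ 2 : ℝ) : ℂ) = ∑ a ∈ F, ∑ b ∈ F, eE (a - b) x := by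
  have : ((‖pF F x‖ ^ 2 : ℝ) : ℂ) = pF F x * (starRingEnd ℂ) (pF F x) := by
    rw [Complex.mul_conj, Complex.normSq_eq_norm_sq]
  rw [this]; unfold pF
  rw [map_sum, Finset.sum_mul_sum]
  simp only [eE_conj, eE_add, sub_eq_add_neg]

lemma pF_L2 (F : Finset ℤ) : ∫ x in (0:ℝ)..1, ‖pF F x‖ ^ 2 = F.card := by
  have h : ((∫ x in (0:ℝ)..1, ‖pF F x‖ ^ 2 : ℝ) : ℂ) = F.card := by
    rw [← intervalIntegral.integral_ofReal]
    simp only [pF_sq]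
    rw [intervalIntegral.integral_finsetSum]
    · have : ∀ a ∈ F, ∫ x in (0:ℝ)..1, ∑ b ∈ F, eE (a - b) x = 1 := by
        intro a ha
        rw [intervalIntegral.integral_finsetSum]
        · simp only [eE_int, sub_eq_zero]
          simp [ha]
        · intro b _; exact (eE_cont _).intervalIntegrable _ _
      rw [Finset.sum_congr rfl this]; simp
    · intro a _
      exact (continuous_finsetSum _ fun i _ => eE_cont _).intervalIntegrable _ _
  exact_mod_cast h

lemma pF_lin (F : Finset ℤ) (n : ℤ) (hn : n ∉ F) :
    ∫ x in (0:ℝ)..1, pF F x * eE (-n) x = 0 := by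
  simp only [pF, Finset.sum_mul, eE_add]
  rw [intervalIntegral.integral_finsetSum]
  · simp only [eE_int]
    refine Finset.sum_eq_zero fun a ha => ?_
    rw [if_neg]; intro h
    exact hn (by rwa [show n = a by omega])
  · intro a _; exact (eE_cont _).intervalIntegrable _ _

noncomputable def cnt (F : Finset ℤ) (n : ℤ) : ℕ :=
  (((F ×ˢ F) ×ˢ F).filter (fun p => p.1.1 - p.1.2 + p.2 + -n = 0)).card

lemma pF_cub (F : Finset ℤ) (n : ℤ) :
    ∫ x in (0:ℝ)..1, ((‖pF F x‖ ^ 2 : ℝ) : ℂ) * pF F x * eE (-n) x = cnt F n := by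
  have : ∀ x, ((‖pF F x‖ ^ 2 : ℝ) : ℂ) * pF F x * eE (-n) x =
      ∑ p ∈ (F ×ˢ F) ×ˢ F, eE (p.1.1 - p.1.2 + p.2 + -n) x := by
    intro x
    rw [pF_sq, ← Finset.sum_product', pF, Finset.sum_mul_sum, ← Finset.sum_product', Finset.sum_mul]
    simp only [eE_add]
  simp only [this]
  rw [intervalIntegral.integral_finsetSum]
  · simp only [eE_int, cnt]
    simp
  · intro a _; exact (eE_cont _).intervalIntegrable _ _

lemma coeff_lower (F : Finset ℤ) (n : ℤ) (hn : n ∉ F) (T : ℝ) (hT : 0 ≤ T)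
    (hs : (F.card : ℝ) ^ 2 * T ≤ 1) :
    T * cnt F n - T ^ 2 * (F.card : ℝ) ^ 4 ≤ ‖fourierCoeff1 (fun x => odeSol (pF F) x T) n‖ := by
  set M : ℝ := (F.card : ℝ) with hMdef
  have hM : 0 ≤ M := Nat.cast_nonneg _
  have c1 := pF_cont F
  have c2 := eE_cont (-n)
  let r : ℝ → ℂ := fun x => pF F x * (Complex.exp (Complex.I * ((‖pF F x‖^2 : ℝ) : ℂ) * (T : ℂ)) - 1
      - Complex.I * ((‖pF F x‖^2 : ℝ) : ℂ) * (T : ℂ)) * eE (-n) x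
  have hr : ∀ x, ‖r x‖ ≤ T ^ 2 * M ^ 3 * ‖pF F x‖ ^ 2 := by
    intro x
    have hp := pF_norm F x
    set y := ‖pF F x‖ with hy
    have hy0 : 0 ≤ y := norm_nonneg _
    have hz : ‖Complex.I * ((y^2 : ℝ) : ℂ) * (T : ℂ)‖ = y ^ 2 * T := by
      rw [norm_mul, norm_mul, Complex.norm_I, Complex.norm_real, Complex.norm_real,
        Real.norm_of_nonneg (by positivity), Real.norm_of_nonneg hT, one_mul]
    have h1 : y ^ 2 * T ≤ 1 := le_trans (by gcongr) hs
    have := Complex.norm_exp_sub_one_sub_id_le (hz.trans_le h1)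
    rw [hz] at this
    simp only [r, norm_mul, eE_norm, mul_one, ← hy]
    calc _ ≤ y * (y ^ 2 * T) ^ 2 := by gcongr
      _ = T ^ 2 * y ^ 3 * y ^ 2 := by ring
      _ ≤ _ := by gcongr
  have hrc : Continuous r := by simp only [r]; fun_prop
  have hrint : ‖∫ x in (0:ℝ)..1, r x‖ ≤ T ^ 2 * M ^ 4 := by
    calc _ ≤ ∫ x in (0:ℝ)..1, T ^ 2 * M ^ 3 * ‖pF F x‖ ^ 2 := by
            apply intervalIntegral.norm_integral_le_of_norm_le (by norm_num)
            · exact Filter.Eventually.of_forall fun x _ => hr x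
            · apply Continuous.intervalIntegrable; fun_prop
      _ = _ := by rw [intervalIntegral.integral_const_mul, pF_L2]; ring
  have hmain : fourierCoeff1 (fun x => odeSol (pF F) x T) n
      = Complex.I * T * cnt F n + ∫ x in (0:ℝ)..1, r x := by
    unfold fourierCoeff1 odeSol
    have : ∀ x : ℝ, pF F x * Complex.exp (Complex.I * ((‖pF F x‖^2 : ℝ) : ℂ) * (T : ℂ)) *
        Complex.exp (-2 * (π : ℂ) * Complex.I * (n : ℂ) * (x : ℂ)) =
        pF F x * eE (-n) x + (Complex.I * T) * (((‖pF F x‖ ^ 2 : ℝ) : ℂ) * pF F x * eE (-n) x) + r x := by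
      intro x
      have : Complex.exp (-2 * (π : ℂ) * Complex.I * (n : ℂ) * (x : ℂ)) = eE (-n) x := by
        unfold eE; congr 1; push_cast; ring
      rw [this]; simp only [r]; ring
    simp only [this]
    rw [intervalIntegral.integral_add, intervalIntegral.integral_add, pF_lin F n hn,
      intervalIntegral.integral_const_mul, pF_cub, zero_add]
    all_goals apply Continuous.intervalIntegrable; fun_prop
  have h3 : ‖Complex.I * (T:ℂ) * (cnt F n : ℂ)‖ = T * cnt F n := by
    rw [norm_mul, norm_mul, Complex.norm_I, Complex.norm_real, Real.norm_of_nonneg hT]; simp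
  rw [hmain]
  have := norm_sub_le_norm_add (Complex.I * (T:ℂ) * (cnt F n : ℂ)) (∫ x in (0:ℝ)..1, r x)
  linarith

noncomputable def FS (N m : ℕ) : Finset ℤ := Finset.Icc ((N:ℤ) - m) (N + m) ∪ Finset.Icc (2 * (N:ℤ) - m) (2 * N + m)

lemma FS_card (N m : ℕ) : (FS N m).card ≤ 2 * (2 * m + 1) := by
  refine (Finset.card_union_le _ _).trans ?_
  simp only [Int.card_Icc]; omega

lemma FS_cnt (N m k : ℕ) (hk : 3 * k ≤ m) (n : ℤ) (h0 : 0 ≤ n) (hn : n ≤ k) :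
    (2 * k + 1) ^ 2 ≤ cnt (FS N m) n := by
  have : (2 * k + 1) ^ 2 = ((Finset.Icc (-(k:ℤ)) k) ×ˢ (Finset.Icc (-(k:ℤ)) k)).card := by
    rw [Finset.card_product, Int.card_Icc, sq]
    congr 1 <;> omega
  rw [this]
  unfold cnt
  apply Finset.card_le_card_of_injOn (fun p => (((N:ℤ) + p.1, 2 * (N:ℤ) + p.2), (N:ℤ) + n - p.1 + p.2))
  · rintro ⟨i, j⟩ h
    simp [FS] at h ⊢
    omega
  · rintro ⟨i, j⟩ _ ⟨i', j'⟩ _ h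
    simp at h ⊢
    omega

lemma phi_eq (A : ℝ) (hA : 0 ≤ A) (N : ℕ) :
    phiPacket 1 A (N:ℝ) = pF (FS N ⌊A / 2⌋₊) := by
  funext x
  unfold phiPacket pF
  have key : ∀ n : ℤ, (|(n:ℝ) - N| ≤ A/2 ∨ |(n:ℝ) - 2*N| ≤ A/2) ↔ n ∈ FS N ⌊A / 2⌋₊ := by
    have aux : ∀ z : ℤ, |(z:ℝ)| ≤ A / 2 ↔ |z| ≤ (⌊A / 2⌋₊ : ℤ) := by
      intro z
      rw [Int.abs_eq_natAbs, Nat.cast_le, Nat.le_floor_iff (by positivity)]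
      rw [Nat.cast_natAbs, Int.cast_abs]
    intro n
    have h1 := aux (n - N)
    have h2 := aux (n - 2 * N)
    push_cast at h1 h2
    rw [h1, h2]
    simp only [FS, Finset.mem_union, Finset.mem_Icc, abs_le]
    omega
  simp only [key]
  rw [tsum_eq_sum (s := FS N ⌊A / 2⌋₊)]
  · simp only [Complex.ofReal_one, one_mul]
    exact Finset.sum_congr rfl fun a ha => by rw [if_pos ha]; rfl
  · intro b hb; rw [if_neg hb]

lemma harm (k : ℕ) : Real.log (k + 1) ≤ ∑ n ∈ Finset.Icc 1 k, (1 / (n:ℝ)) := by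
  have := log_add_one_le_harmonic k
  rw [harmonic_eq_sum_Icc] at this
  push_cast at this
  simpa using this

lemma main_bound (N : ℕ) (l : ℝ) (hl : 10 ≤ l) (hN : 3 ≤ N) (h8 : 8 * l ≤ Real.sqrt N)
    (hL : Real.log N = l ^ 16) :
    (l ^ 4 / 64) ^ 2 ≤ ∑' n : ℤ,
          if |n| < (N : ℤ) then
            ((1:ℝ) + (n:ℝ)^2) ^ (-(1:ℝ)/2) *
              ‖fourierCoeff1
                (fun x => odeSol (phiPacket 1 ((N:ℝ) / l) (N:ℝ)) x (1 / ((N:ℝ)^2 * l ^ 2))) n‖^2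
          else 0 := by
  have hN0 : (3:ℝ) ≤ N := by exact_mod_cast hN
  set A : ℝ := N / l with hA
  set T : ℝ := 1 / ((N:ℝ)^2 * l ^ 2) with hT
  have hl0 : 0 < l := by linarith
  have hT0 : 0 ≤ T := by positivity
  have hsq : Real.sqrt N * Real.sqrt N = N := Real.mul_self_sqrt (by positivity)
  have hs80 : 80 ≤ Real.sqrt N := by linarith
  have hA8 : 8 * Real.sqrt N ≤ A := by
    rw [hA, le_div_iff₀ hl0]; nlinarith
  have hAN : A ≤ N / 10 := by rw [hA]; gcongr
  have hAT : A ^ 2 * T = 1 / l ^ 4 := by rw [hA, hT]; field_simp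
  have hA0 : 0 ≤ A := by positivity
  rw [phi_eq A hA0]
  set m := ⌊A / 2⌋₊ with hm
  have hm1 : (m:ℝ) ≤ A / 2 := Nat.floor_le (by positivity)
  have hm2 : A / 2 < m + 1 := Nat.lt_floor_add_one _
  obtain ⟨k, hk1, hk2⟩ : ∃ k : ℕ, 3 * k ≤ m ∧ m ≤ 3 * k + 2 := ⟨m / 3, by omega, by omega⟩
  have hk1' : 3 * (k:ℝ) ≤ m := by exact_mod_cast hk1
  have hk2' : (m:ℝ) ≤ 3 * k + 2 := by exact_mod_cast hk2
  set M : ℝ := ((FS N m).card : ℝ) with hM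
  have hM0 : 0 ≤ M := Nat.cast_nonneg _
  have hM1 : M ≤ 4 * A := by
    have : M ≤ 2 * (2 * m + 1) := by rw [hM]; exact_mod_cast FS_card N m
    linarith
  have hl4 : (10:ℝ) ^ 4 ≤ l ^ 4 := by gcongr
  have hMT : M ^ 2 * T ≤ 16 / l ^ 4 := by
    calc M ^ 2 * T ≤ (4 * A) ^ 2 * T := by gcongr
      _ = 16 * (A ^ 2 * T) := by ring
      _ = _ := by rw [hAT]; ring
  have hs : M ^ 2 * T ≤ 1 := hMT.trans (by rw [div_le_one (by positivity)]; linarith)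
  have hco : ∀ n : ℤ, 0 ≤ n → n ≤ k →
      1 / (32 * l ^ 4) ≤ ‖fourierCoeff1 (fun x => odeSol (pF (FS N m)) x T) n‖ := by
    intro n h0 hn
    have hnF : n ∉ FS N m := by
      have : 3 * m < N := by
        have : 3 * (m:ℝ) < N := by linarith
        exact_mod_cast this
      simp only [FS, Finset.mem_union, Finset.mem_Icc]
      omega
    refine le_trans ?_ (coeff_lower (FS N m) n hnF T hT0 hs)
    have hc : ((2 * k + 1 : ℝ)) ^ 2 ≤ cnt (FS N m) n := by
      exact_mod_cast FS_cnt N m k hk1 n h0 hn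
    have hc2 : (A / 4) ^ 2 ≤ cnt (FS N m) n := by
      refine le_trans ?_ hc
      gcongr
      linarith
    have e1 : 1 / (16 * l ^ 4) ≤ T * cnt (FS N m) n := by
      calc _ = T * (A / 4) ^ 2 := by
              rw [show T * (A / 4) ^ 2 = (A ^ 2 * T) / 16 by ring, hAT]; field_simp
        _ ≤ _ := by gcongr
    have e2 : T ^ 2 * M ^ 4 ≤ 1 / (32 * l ^ 4) := by
      calc T ^ 2 * M ^ 4 = (M ^ 2 * T) ^ 2 := by ring
        _ ≤ (16 / l ^ 4) ^ 2 := by gcongr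
        _ ≤ _ := by
          rw [div_pow, div_le_div_iff₀ (by positivity) (by positivity)]
          nlinarith
    have e3 : 1 / (16 * l ^ 4) = 1 / (32 * l ^ 4) + 1 / (32 * l ^ 4) := by field_simp; norm_num
    linarith
  set g : ℤ → ℝ := fun n => if |n| < (N : ℤ) then
            ((1:ℝ) + (n:ℝ)^2) ^ (-(1:ℝ)/2) *
              ‖fourierCoeff1 (fun x => odeSol (pF (FS N m)) x T) n‖^2 else 0 with hg
  have hg0 : ∀ n, 0 ≤ g n := by
    intro n; simp only [hg]; split_ifs <;> positivity
  have hsum : Summable g := by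
    apply summable_of_ne_finset_zero (s := Finset.Ioo (-(N:ℤ)) N)
    intro b hb
    simp only [hg]; rw [if_neg]
    rw [abs_lt]; simpa using hb
  have hkN : (k:ℤ) < N := by
    have : (k:ℝ) < N := by linarith
    exact_mod_cast this
  have hterm : ∀ n ∈ Finset.Icc 1 k, 1 / (n:ℝ) * (1 / 2 * (1 / (32 * l ^ 4)) ^ 2) ≤ g (n:ℤ) := by
    intro n hn
    rw [Finset.mem_Icc] at hn
    have hn1 : (1:ℝ) ≤ n := by exact_mod_cast hn.1
    simp only [hg]
    rw [if_pos (by rw [abs_of_nonneg (by omega)]; omega), ← mul_assoc]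
    have := hco n (by omega) (by omega)
    gcongr
    rw [neg_div, Real.rpow_neg (by positivity), ← Real.sqrt_eq_rpow]
    rw [show 1 / (n:ℝ) * (1 / 2) = (2 * (n:ℝ))⁻¹ by field_simp]
    apply inv_anti₀ (by positivity)
    rw [Real.sqrt_le_left (by positivity)]
    push_cast
    nlinarith
  have h1 : ∑ n ∈ Finset.Icc 1 k, g (n:ℤ) ≤ ∑' n, g n := by
    rw [← Finset.sum_image (f := g) (g := fun n : ℕ => (n:ℤ)) (by intro a _ b _ h; simpa using h)]
    exact hsum.sum_le_tsum _ (fun i _ => hg0 i)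
  have hlogk : l ^ 16 / 2 ≤ Real.log (k + 1) := by
    rw [← hL, ← Real.log_sqrt (by positivity)]
    apply Real.log_le_log (by linarith)
    linarith
  calc (l ^ 4 / 64) ^ 2 ≤ (l ^ 16 / 2) * (1 / 2 * (1 / (32 * l ^ 4)) ^ 2) := by
        apply le_of_eq; field_simp; norm_num
    _ ≤ (∑ n ∈ Finset.Icc 1 k, 1 / (n:ℝ)) * (1 / 2 * (1 / (32 * l ^ 4)) ^ 2) := by
        gcongr; exact hlogk.trans (harm k)
    _ = ∑ n ∈ Finset.Icc 1 k, 1 / (n:ℝ) * (1 / 2 * (1 / (32 * l ^ 4)) ^ 2) := by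
        rw [Finset.sum_mul]
    _ ≤ _ := (Finset.sum_le_sum hterm).trans h1

/-- High-to-low energy transfer for the dispersionless ODE at the critical
regularity `s = −1/2`: with `A = N/(log N)^{1/16}` and
`T_N = 1/(N²(log N)^{1/8})`, the low frequency part of `w(T_N)` has
`H^{−1/2}` norm at least `c (log N)^{1/4}`. -/
theorem ode_high_to_low_critical :
    ∃ c : ℝ, 0 < c ∧ ∃ N₀ : ℕ, ∀ N : ℕ, N₀ ≤ N →
      c * (Real.log N) ^ ((1:ℝ)/4) ≤
        Real.sqrt (∑' n : ℤ,
          if |n| < (N : ℤ) then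
            ((1:ℝ) + (n:ℝ)^2) ^ (-(1:ℝ)/2) *
              ‖fourierCoeff1
                (fun x => odeSol
                  (phiPacket 1 ((N:ℝ) / (Real.log N) ^ ((1:ℝ)/16)) (N:ℝ))
                  x (1 / ((N:ℝ)^2 * (Real.log N) ^ ((1:ℝ)/8)))) n‖^2
          else 0) := by
  have hl1 : ∀ᶠ x : ℝ in Filter.atTop, 8 * Real.log x ≤ Real.sqrt x := by
    have := (isLittleO_log_rpow_atTop (r := 1/2) (by norm_num)).bound (c := 1/8) (by norm_num)
    filter_upwards [this, Filter.eventually_ge_atTop 1] with x hx h1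
    rw [Real.norm_of_nonneg (Real.log_nonneg h1), Real.norm_of_nonneg (by positivity),
      ← Real.sqrt_eq_rpow] at hx
    linarith
  have hl2 : ∀ᶠ x : ℝ in Filter.atTop, (10:ℝ) ^ 16 ≤ Real.log x :=
    Real.tendsto_log_atTop.eventually_ge_atTop _
  obtain ⟨N₀, hN₀⟩ := Filter.eventually_atTop.1
    (tendsto_natCast_atTop_atTop.eventually (hl1.and hl2))
  refine ⟨1 / 64, by norm_num, max N₀ 3, fun N hN => ?_⟩
  obtain ⟨h1, h2⟩ := hN₀ N (le_trans (le_max_left _ _) hN)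
  have h3 : 3 ≤ N := le_trans (le_max_right _ _) hN
  set L := Real.log N with hL
  have hL0 : 0 ≤ L := le_trans (by norm_num) h2
  set l := L ^ ((1:ℝ)/16) with hl
  have hl0 : 0 ≤ l := by positivity
  have hl16 : L = l ^ 16 := by
    rw [hl, ← Real.rpow_natCast, ← Real.rpow_mul hL0]; norm_num
  have hl8 : L ^ ((1:ℝ)/8) = l ^ 2 := by
    rw [hl, ← Real.rpow_natCast, ← Real.rpow_mul hL0]; norm_num
  have hl4 : L ^ ((1:ℝ)/4) = l ^ 4 := by
    rw [hl, ← Real.rpow_natCast, ← Real.rpow_mul hL0]; norm_num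
  have h10 : 10 ≤ l := by
    rw [hl16] at h2
    exact le_of_pow_le_pow_left₀ (by norm_num) hl0 h2
  have hlL : l ≤ L := by
    rw [hl16]; exact le_self_pow₀ (by linarith) (by norm_num)
  rw [hl8, hl4]
  apply Real.le_sqrt_of_sq_le
  rw [show 1 / 64 * l ^ 4 = l ^ 4 / 64 by ring]
  exact main_bound N l h10 h3 (by linarith) hl16
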